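/- Let n ≥ 1, let p⃗, q⃗, s⃗ be n-tuples with 1 ≤ pᵢ, qᵢ, sᵢ ≤ ∞ and let 1 ≤ α ≤ ∞ satisfy (1/n)Σᵢ 1/sᵢ ≤ 1/α ≤ (1/n)Σᵢ 1/pᵢ and (1/n)Σᵢ 1/sᵢ ≤ 1/α ≤ (1/n)Σᵢ 1/qᵢ. If pᵢ ≤ qᵢ for every i, then there is a constant C > 0, independent of f, such that ‖f‖_{(L^{p⃗},L^{s⃗})^α} ≤ C·‖f‖_{(L^{q⃗},L^{s⃗})^α} for every locally integrable f; in particular (L^{q⃗},L^{s⃗})^α(ℝⁿ) ⊆ (L^{p⃗},L^{s⃗})^α(ℝⁿ). -/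

import Mathlib

open MeasureTheory ENNReal Filter Topology Set

noncomputable section

namespace MixedAmalgam

/-- `L^p` norm over `ℝ` of an `ℝ≥0∞`-valued function, with the usual
modification (`essSup`) for `p = ∞`. -/
def lpInt (p : ℝ≥0∞) (g : ℝ → ℝ≥0∞) : ℝ≥0∞ :=
  if p = ∞ then essSup g volume else (∫⁻ t, g t ^ p.toReal) ^ (1 / p.toReal)

/-- `ℓ^p` norm over `ℤ` of an `ℝ≥0∞`-valued family, with the usual
modification for `p = ∞`. -/
def lpSum (p : ℝ≥0∞) (g : ℤ → ℝ≥0∞) : ℝ≥0∞ :=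
  if p = ∞ then ⨆ k, g k else (∑' k, g k ^ p.toReal) ^ (1 / p.toReal)

/-- Iterated mixed Lebesgue norm of an `ℝ≥0∞`-valued function on `ℝⁿ`,
taking the `L^{p₁}` norm in the first variable innermost, and the `L^{pₙ}`
norm in the last variable outermost. -/
def mixedE : (n : ℕ) → (Fin n → ℝ≥0∞) → ((Fin n → ℝ) → ℝ≥0∞) → ℝ≥0∞
  | 0, _, g => g Fin.elim0
  | n + 1, p, g =>
    lpInt (p (Fin.last n)) fun t =>
      mixedE n (fun i => p i.castSucc) fun x => g (Fin.snoc x t)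

/-- Mixed-norm Lebesgue norm `‖f‖_{L^{p⃗}}` of a real-valued function on `ℝⁿ`. -/
def mixedLp (n : ℕ) (p : Fin n → ℝ≥0∞) (f : (Fin n → ℝ) → ℝ) : ℝ≥0∞ :=
  mixedE n p fun x => (‖f x‖₊ : ℝ≥0∞)

/-- Iterated mixed `ℓ^{s⃗}` norm of an `ℝ≥0∞`-valued family indexed by `ℤⁿ`. -/
def mixedSeq : (n : ℕ) → (Fin n → ℝ≥0∞) → ((Fin n → ℤ) → ℝ≥0∞) → ℝ≥0∞
  | 0, _, a => a Fin.elim0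
  | n + 1, s, a =>
    lpSum (s (Fin.last n)) fun k =>
      mixedSeq n (fun i => s i.castSucc) fun m => a (Fin.snoc m k)

/-- Open Euclidean ball of center `y` and radius `r` in `ℝⁿ`. -/
def eball (n : ℕ) (y : Fin n → ℝ) (r : ℝ) : Set (Fin n → ℝ) :=
  {x | Real.sqrt (∑ i, (x i - y i) ^ 2) < r}

/-- `Σᵢ 1/pᵢ` as a real number. -/
def invSum (n : ℕ) (p : Fin n → ℝ≥0∞) : ℝ :=
  ∑ i, (1 / p i).toReal

/-- The `(L^{p⃗},L^{s⃗})` amalgam norm computed with balls of radius `r`. -/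
def amalgamNormR (n : ℕ) (p s : Fin n → ℝ≥0∞) (r : ℝ) (f : (Fin n → ℝ) → ℝ) : ℝ≥0∞ :=
  mixedE n s fun y => mixedLp n p ((eball n y r).indicator f)

/-- The amalgam norm `‖f‖_{(L^{p⃗},L^{s⃗})}`. -/
def amalgamNorm (n : ℕ) (p s : Fin n → ℝ≥0∞) (f : (Fin n → ℝ) → ℝ) : ℝ≥0∞ :=
  amalgamNormR n p s 1 f

/-- The amalgam norm `‖f‖_{(L^{p⃗},L^{s⃗})^α}`. -/
def amalgamNormA (n : ℕ) (p s : Fin n → ℝ≥0∞) (α : ℝ≥0∞) (f : (Fin n → ℝ) → ℝ) : ℝ≥0∞ :=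
  ⨆ (r : ℝ) (_ : 0 < r),
    mixedE n s fun y =>
      volume (eball n y r) ^
          ((1 / α).toReal - invSum n p / (n : ℝ) - invSum n s / (n : ℝ)) *
        mixedLp n p ((eball n y r).indicator f)

/-- The amalgam norm `‖·‖_{(L^{p⃗},L^{s⃗})^α}` for `ℝ≥0∞`-valued functions. -/
def amalgamNormAE (n : ℕ) (p s : Fin n → ℝ≥0∞) (α : ℝ≥0∞)
    (g : (Fin n → ℝ) → ℝ≥0∞) : ℝ≥0∞ :=
  ⨆ (r : ℝ) (_ : 0 < r),
    mixedE n s fun y =>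
      volume (eball n y r) ^
          ((1 / α).toReal - invSum n p / (n : ℝ) - invSum n s / (n : ℝ)) *
        mixedE n p ((eball n y r).indicator g)

/-- The cube `Q_{r,k} = r(k + [0,1)ⁿ)`. -/
def qcube (n : ℕ) (r : ℝ) (k : Fin n → ℤ) : Set (Fin n → ℝ) :=
  {x | ∀ i, r * (k i : ℝ) ≤ x i ∧ x i < r * ((k i : ℝ) + 1)}

/-- The discrete amalgam norm `_r‖f‖_{p⃗,s⃗}`. -/
def discNormR (n : ℕ) (p s : Fin n → ℝ≥0∞) (r : ℝ) (f : (Fin n → ℝ) → ℝ) : ℝ≥0∞ :=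
  mixedSeq n s fun k => mixedLp n p ((qcube n r k).indicator f)

/-- The discrete amalgam norm `‖f‖_{p⃗,s⃗} = _1‖f‖_{p⃗,s⃗}`. -/
def discNorm (n : ℕ) (p s : Fin n → ℝ≥0∞) (f : (Fin n → ℝ) → ℝ) : ℝ≥0∞ :=
  discNormR n p s 1 f

/-- The discrete amalgam norm
`‖f‖_{p⃗,s⃗,α} = sup_{r>0} r^{n/α - Σᵢ 1/pᵢ} · _r‖f‖_{p⃗,s⃗}`. -/
def discNormA (n : ℕ) (p s : Fin n → ℝ≥0∞) (α : ℝ≥0∞) (f : (Fin n → ℝ) → ℝ) : ℝ≥0∞ :=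
  ⨆ (r : ℝ) (_ : 0 < r),
    ENNReal.ofReal (r ^ ((n : ℝ) * (1 / α).toReal - invSum n p)) * discNormR n p s r f

/-- Membership in `(L^{p⃗},L^{s⃗})^α(ℝⁿ)` (continuous form). -/
def memA (n : ℕ) (p s : Fin n → ℝ≥0∞) (α : ℝ≥0∞) (f : (Fin n → ℝ) → ℝ) : Prop :=
  LocallyIntegrable f volume ∧ amalgamNormA n p s α f < ∞

/-- Membership in `(L^{p⃗},ℓ^{s⃗})(ℝⁿ)`. -/
def memD (n : ℕ) (p s : Fin n → ℝ≥0∞) (f : (Fin n → ℝ) → ℝ) : Prop :=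
  LocallyIntegrable f volume ∧ discNorm n p s f < ∞

/-- Membership in `(L^{p⃗},ℓ^{s⃗})^α(ℝⁿ)`. -/
def memDA (n : ℕ) (p s : Fin n → ℝ≥0∞) (α : ℝ≥0∞) (f : (Fin n → ℝ) → ℝ) : Prop :=
  LocallyIntegrable f volume ∧ discNormA n p s α f < ∞

/-- The dilation `St_r^{(α)} f = r^{-n/α} f(r⁻¹ ·)`. -/
def dil (n : ℕ) (α : ℝ≥0∞) (r : ℝ) (f : (Fin n → ℝ) → ℝ) : (Fin n → ℝ) → ℝ :=
  fun x => r ^ (-((n : ℝ) * (1 / α).toReal)) * f (r⁻¹ • x)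

/-- A block decomposition `f = Σ_j c_j St_{r_j}^{(α')} f_j` converging in `L¹_loc`. -/
structure BlockDecomp (n : ℕ) (p' s' : Fin n → ℝ≥0∞) (α' : ℝ≥0∞) (f : (Fin n → ℝ) → ℝ)
    (c : ℕ → ℝ) (rr : ℕ → ℝ) (g : ℕ → (Fin n → ℝ) → ℝ) : Prop where
  csummable : Summable fun j => |c j|
  rpos : ∀ j, 0 < rr j
  gloc : ∀ j, LocallyIntegrable (g j) volume
  gnorm : ∀ j, discNorm n p' s' (g j) ≤ 1
  conv : ∀ K : Set (Fin n → ℝ), IsCompact K →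
    Tendsto (fun J : ℕ =>
        ∫⁻ x in K,
          (‖f x - ∑ j ∈ Finset.range J, c j * dil n α' (rr j) (g j) x‖₊ : ℝ≥0∞))
      atTop (𝓝 0)

/-- Membership in the block space `H(p⃗',s⃗',α')`. -/
def memH (n : ℕ) (p' s' : Fin n → ℝ≥0∞) (α' : ℝ≥0∞) (f : (Fin n → ℝ) → ℝ) : Prop :=
  LocallyIntegrable f volume ∧ ∃ c rr g, BlockDecomp n p' s' α' f c rr g

/-- The norm of the block space `H(p⃗',s⃗',α')`. -/
def hNorm (n : ℕ) (p' s' : Fin n → ℝ≥0∞) (α' : ℝ≥0∞) (f : (Fin n → ℝ) → ℝ) : ℝ≥0∞ :=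
  ⨅ (c : ℕ → ℝ) (rr : ℕ → ℝ) (g : ℕ → (Fin n → ℝ) → ℝ)
    (_ : BlockDecomp n p' s' α' f c rr g), ENNReal.ofReal (∑' j, |c j|)

/-- The fractional integral operator `I_γ`. -/
def fracInt (n : ℕ) (γ : ℝ) (f : (Fin n → ℝ) → ℝ) : (Fin n → ℝ) → ℝ :=
  fun x => ∫ y, f y / Real.sqrt (∑ i, (x i - y i) ^ 2) ^ ((n : ℝ) - γ)

/-- The fractional maximal operator `M_γ`. -/
def fracMax (n : ℕ) (γ : ℝ) (f : (Fin n → ℝ) → ℝ) : (Fin n → ℝ) → ℝ≥0∞ :=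
  fun x => ⨆ (y : Fin n → ℝ) (r : ℝ) (_ : 0 < r) (_ : x ∈ eball n y r),
    volume (eball n y r) ^ (γ / (n : ℝ) - 1) * ∫⁻ z in eball n y r, (‖f z‖₊ : ℝ≥0∞)

/-- The commutator `[b, I_γ] f`. -/
def commFracInt (n : ℕ) (γ : ℝ) (b f : (Fin n → ℝ) → ℝ) : (Fin n → ℝ) → ℝ :=
  fun x => ∫ y, (b x - b y) * f y / Real.sqrt (∑ i, (x i - y i) ^ 2) ^ ((n : ℝ) - γ)

/-- The mean value `b_B` of `b` over the ball `B(y,r)`. -/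
def ballAvg (n : ℕ) (b : (Fin n → ℝ) → ℝ) (y : Fin n → ℝ) (r : ℝ) : ℝ :=
  (volume (eball n y r)).toReal⁻¹ * ∫ x in eball n y r, b x

/-- The `BMO` norm `sup_B (1/|B|) ∫_B |b - b_B|`. -/
def bmoNorm (n : ℕ) (b : (Fin n → ℝ) → ℝ) : ℝ≥0∞ :=
  ⨆ (y : Fin n → ℝ) (r : ℝ) (_ : 0 < r),
    ENNReal.ofReal
      ((volume (eball n y r)).toReal⁻¹ * ∫ x in eball n y r, |b x - ballAvg n b y r|)

theorem lpInt_eq_eLpNorm (p : ℝ≥0∞) (hp : 1 ≤ p) (g : ℝ → ℝ≥0∞) :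
    lpInt p g = eLpNorm g p volume := by
  unfold lpInt
  split_ifs with h
  · subst h
    simp [eLpNorm_exponent_top, eLpNormEssSup_eq_essSup_enorm]
  · rw [eLpNorm_eq_lintegral_rpow_enorm_toReal (by positivity) h]
    simp

theorem lpInt_mono (p : ℝ≥0∞) (hp : 1 ≤ p) {g h : ℝ → ℝ≥0∞} (hgh : ∀ t, g t ≤ h t) :
    lpInt p g ≤ lpInt p h := by
  rw [lpInt_eq_eLpNorm p hp, lpInt_eq_eLpNorm p hp]
  exact eLpNorm_mono_enorm (by simpa using hgh)

theorem lpInt_const_mul (p : ℝ≥0∞) (hp : 1 ≤ p) (c : ℝ≥0∞) (hc : c ≠ ∞) (g : ℝ → ℝ≥0∞) :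
    lpInt p (fun t => c * g t) = c * lpInt p g := by
  unfold lpInt
  split_ifs with h
  · exact ENNReal.essSup_const_mul
  · have hp0 : 0 < p.toReal := ENNReal.toReal_pos (by positivity) h
    simp_rw [ENNReal.mul_rpow_of_nonneg _ _ hp0.le]
    rw [lintegral_const_mul' _ _ (ENNReal.rpow_ne_top_of_nonneg hp0.le hc),
      ENNReal.mul_rpow_of_nonneg _ _ (by positivity), ← ENNReal.rpow_mul]
    rw [mul_one_div_cancel hp0.ne', ENNReal.rpow_one]

theorem lpInt_holder (p q : ℝ≥0∞) (hp : 1 ≤ p) (hpq : p ≤ q) (S : Set ℝ)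
    (hS : MeasurableSet S) (g : ℝ → ℝ≥0∞) (hg : ∀ t, t ∉ S → g t = 0) :
    lpInt p g ≤ volume S ^ ((1 / p).toReal - (1 / q).toReal) * lpInt q g := by
  by_cases hpt : p = ∞
  · subst hpt
    have : q = ∞ := top_le_iff.mp hpq
    subst this
    simp
  have hp0 : 0 < p.toReal := ENNReal.toReal_pos (by positivity) hpt
  obtain ⟨h, hm, hle, heq⟩ := exists_measurable_le_lintegral_eq (μ := volume)
    (fun t => g t ^ p.toReal)
  set u : ℝ → ℝ≥0∞ := fun t => h t ^ (1 / p.toReal) with hu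
  have hum : Measurable u := hm.pow_const _
  have hug : ∀ t, u t ≤ g t := by
    intro t
    have := ENNReal.rpow_le_rpow (hle t) (z := 1 / p.toReal) (by positivity)
    simp only [← ENNReal.rpow_mul] at this
    rw [mul_one_div_cancel hp0.ne', ENNReal.rpow_one] at this
    exact this
  have h1 : lpInt p g = lpInt p u := by
    unfold lpInt
    rw [if_neg hpt, if_neg hpt, heq]
    congr 2
    ext t
    rw [hu, ← ENNReal.rpow_mul, one_div_mul_cancel hp0.ne', ENNReal.rpow_one]
  have h2 : S.indicator u = u := by
    rw [Set.indicator_eq_self]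
    intro t ht
    by_contra hts
    have := hug t
    rw [hg t hts] at this
    exact ht (le_antisymm this (by simp))
  rw [h1, lpInt_eq_eLpNorm p hp]
  calc eLpNorm u p volume = eLpNorm u p (volume.restrict S) := by
        rw [← eLpNorm_indicator_eq_eLpNorm_restrict hS, h2]
    _ ≤ eLpNorm u q (volume.restrict S) *
        (volume.restrict S) Set.univ ^ (1 / p.toReal - 1 / q.toReal) :=
        eLpNorm_le_eLpNorm_mul_rpow_measure_univ hpq hum.aestronglyMeasurable
    _ ≤ eLpNorm u q volume * volume S ^ ((1 / p).toReal - (1 / q).toReal) := by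
        rw [Measure.restrict_apply_univ]
        simp only [one_div, ENNReal.toReal_inv]
        gcongr
        exact Measure.restrict_le_self
    _ = volume S ^ ((1 / p).toReal - (1 / q).toReal) * lpInt q u := by
        rw [lpInt_eq_eLpNorm q (hp.trans hpq), mul_comm]
    _ ≤ _ := by
        gcongr
        exact lpInt_mono q (hp.trans hpq) hug

theorem mixedE_mono : ∀ (n : ℕ) (p : Fin n → ℝ≥0∞) (_ : ∀ i, 1 ≤ p i)
    (g h : (Fin n → ℝ) → ℝ≥0∞) (_ : ∀ x, g x ≤ h x), mixedE n p g ≤ mixedE n p h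
  | 0, _, _, _, _, hgh => hgh _
  | n + 1, p, hp, g, h, hgh => by
    unfold mixedE
    exact lpInt_mono _ (hp _) fun t => mixedE_mono n _ (fun i => hp _) _ _ fun x => hgh _

theorem mixedE_const_mul (c : ℝ≥0∞) (hc : c ≠ ∞) : ∀ (n : ℕ) (p : Fin n → ℝ≥0∞)
    (_ : ∀ i, 1 ≤ p i) (g : (Fin n → ℝ) → ℝ≥0∞),
    mixedE n p (fun x => c * g x) = c * mixedE n p g
  | 0, _, _, _ => rfl
  | n + 1, p, hp, g => by
    unfold mixedE
    rw [← lpInt_const_mul _ (hp _) c hc]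
    congr 1
    ext t
    exact mixedE_const_mul c hc n _ (fun i => hp _) _

theorem mixedE_zero (n : ℕ) (p : Fin n → ℝ≥0∞) (hp : ∀ i, 1 ≤ p i)
    (g : (Fin n → ℝ) → ℝ≥0∞) (hg : ∀ x, g x = 0) : mixedE n p g = 0 := by
  have := mixedE_const_mul 0 (by simp) n p hp g
  have h2 : (fun x => 0 * g x) = g := by ext x; simp [hg]
  rw [h2] at this
  simpa using this

theorem mixedE_holder (L : ℝ≥0∞) (hL0 : L ≠ 0) (hL : L ≠ ∞) : ∀ (n : ℕ) (p q : Fin n → ℝ≥0∞)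
    (_ : ∀ i, 1 ≤ p i) (_ : ∀ i, p i ≤ q i) (S : Fin n → Set ℝ)
    (_ : ∀ i, MeasurableSet (S i)) (_ : ∀ i, volume (S i) = L)
    (g : (Fin n → ℝ) → ℝ≥0∞) (_ : ∀ x, (∃ i, x i ∉ S i) → g x = 0),
    mixedE n p g ≤ L ^ (invSum n p - invSum n q) * mixedE n q g
  | 0, p, q, _, _, _, _, _, g, _ => by simp [mixedE, invSum]
  | n + 1, p, q, hp, hpq, S, hS, hSL, g, hg => by
    have ih : ∀ t, mixedE n (fun i => p i.castSucc) (fun x => g (Fin.snoc x t)) ≤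
        L ^ (invSum n (fun i => p i.castSucc) - invSum n (fun i => q i.castSucc)) *
          mixedE n (fun i => q i.castSucc) (fun x => g (Fin.snoc x t)) := fun t =>
      mixedE_holder L hL0 hL n _ _ (fun i => hp _) (fun i => hpq _) (fun i => S i.castSucc)
        (fun i => hS _) (fun i => hSL _) _ (by
          rintro x ⟨i, hi⟩
          exact hg _ ⟨i.castSucc, by simpa using hi⟩)
    have hq : ∀ i, 1 ≤ q i := fun i => (hp i).trans (hpq i)
    have e : invSum (n + 1) p - invSum (n + 1) q =
        (invSum n (fun i => p i.castSucc) - invSum n (fun i => q i.castSucc)) +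
        ((1 / p (Fin.last n)).toReal - (1 / q (Fin.last n)).toReal) := by
      simp only [invSum, Fin.sum_univ_castSucc]
      ring
    rw [e, ENNReal.rpow_add _ _ hL0 hL, mul_assoc]
    unfold mixedE
    refine (lpInt_mono _ (hp _) ih).trans ?_
    rw [lpInt_const_mul _ (hp _) _ (ENNReal.rpow_ne_top_of_ne_zero hL0 hL)]
    gcongr
    rw [← hSL (Fin.last n)]
    refine lpInt_holder _ _ (hp _) (hpq _) _ (hS _) _ fun t ht => ?_
    refine mixedE_zero n _ (fun i => hq _) _ fun x => hg _ ⟨Fin.last n, by simpa using ht⟩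

theorem eball_coord {n : ℕ} {y x : Fin n → ℝ} {r : ℝ} (hx : x ∈ eball n y r) (i : Fin n) :
    |x i - y i| < r := by
  refine lt_of_le_of_lt ?_ hx
  apply Real.abs_le_sqrt
  exact Finset.single_le_sum (f := fun i => (x i - y i) ^ 2) (fun j _ => sq_nonneg _)
    (Finset.mem_univ i)

theorem eball_subset {n : ℕ} {y : Fin n → ℝ} {r : ℝ} (hr : 0 < r) :
    eball n y r ⊆ Metric.ball y r := by
  intro x hx
  rw [Metric.mem_ball, dist_pi_lt_iff hr]
  intro i
  exact eball_coord hx i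

theorem subset_eball {n : ℕ} (hn : 1 ≤ n) {y : Fin n → ℝ} {r : ℝ} (hr : 0 < r) :
    Metric.ball y (r / n) ⊆ eball n y r := by
  have hn' : (1 : ℝ) ≤ n := by exact_mod_cast hn
  intro x hx
  rw [Metric.mem_ball, dist_pi_lt_iff (by positivity)] at hx
  show Real.sqrt _ < r
  rw [Real.sqrt_lt' hr]
  have hd : ∀ i ∈ (Finset.univ : Finset (Fin n)), (x i - y i) ^ 2 < (r / n) ^ 2 := by
    intro i _
    have := hx i
    rw [Real.dist_eq] at this
    exact sq_lt_sq' (abs_lt.mp this).1 (abs_lt.mp this).2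
  have hne : (Finset.univ : Finset (Fin n)).Nonempty := ⟨⟨0, hn⟩, Finset.mem_univ _⟩
  refine (Finset.sum_lt_sum_of_nonempty hne hd).trans_le ?_
  simp only [Finset.sum_const, Finset.card_univ, Fintype.card_fin, nsmul_eq_mul]
  have : (n : ℝ) * (r / n) ^ 2 = r ^ 2 / n := by field_simp
  rw [this]
  exact div_le_self (by positivity) hn'

theorem two_r_le {n : ℕ} (hn : 1 ≤ n) (y : Fin n → ℝ) {r : ℝ} (hr : 0 < r) :
    ENNReal.ofReal (2 * r) ≤ n * volume (eball n y r) ^ (1 / (n : ℝ)) := by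
  have hn' : (1 : ℝ) ≤ n := by exact_mod_cast hn
  have h := measure_mono (μ := volume) (subset_eball hn (y := y) hr)
  rw [Real.volume_pi_ball y (by positivity), Fintype.card_fin,
    ENNReal.ofReal_pow (by positivity)] at h
  have h2 := ENNReal.rpow_le_rpow h (z := 1 / (n : ℝ)) (by positivity)
  rw [← ENNReal.rpow_natCast, ← ENNReal.rpow_mul, mul_one_div_cancel (by positivity),
    ENNReal.rpow_one] at h2
  calc ENNReal.ofReal (2 * r) = n * ENNReal.ofReal (2 * (r / n)) := by
        rw [← ENNReal.ofReal_natCast, ← ENNReal.ofReal_mul (by positivity)]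
        congr 1
        field_simp
    _ ≤ _ := by gcongr

/-- If `pᵢ ≤ qᵢ` for all `i` then
`(L^{q⃗},L^{s⃗})^α(ℝⁿ) ⊆ (L^{p⃗},L^{s⃗})^α(ℝⁿ)` with
`‖f‖_{(L^{p⃗},L^{s⃗})^α} ≤ C ‖f‖_{(L^{q⃗},L^{s⃗})^α}`. -/
theorem statement3 (n : ℕ) (hn : 1 ≤ n) (p q s : Fin n → ℝ≥0∞) (α : ℝ≥0∞)
    (hp : ∀ i, 1 ≤ p i) (hq : ∀ i, 1 ≤ q i) (hs : ∀ i, 1 ≤ s i) (hα : 1 ≤ α)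
    (hα1 : invSum n s / (n : ℝ) ≤ (1 / α).toReal)
    (hα2 : (1 / α).toReal ≤ invSum n p / (n : ℝ))
    (hα3 : (1 / α).toReal ≤ invSum n q / (n : ℝ))
    (hpq : ∀ i, p i ≤ q i) :
    ∃ C : ℝ≥0∞, 0 < C ∧ C < ∞ ∧
      ∀ f : (Fin n → ℝ) → ℝ, LocallyIntegrable f volume →
        amalgamNormA n p s α f ≤ C * amalgamNormA n q s α f := by
  have hn' : (1 : ℝ) ≤ n := by exact_mod_cast hn
  have hD : 0 ≤ invSum n p - invSum n q := by
    rw [sub_nonneg]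
    refine Finset.sum_le_sum fun i _ => ?_
    have h0 : p i ≠ 0 := (zero_lt_one.trans_le (hp i)).ne'
    refine ENNReal.toReal_mono ?_ ?_
    · simpa using h0
    · exact ENNReal.div_le_div_left (hpq i) 1
  set D := invSum n p - invSum n q with hDdef
  have hC0 : (n : ℝ≥0∞) ≠ 0 := by
    have : n ≠ 0 := by omega
    exact_mod_cast this
  have hCt : (n : ℝ≥0∞) ^ D ≠ ∞ := ENNReal.rpow_ne_top_of_nonneg hD (by simp)
  refine ⟨(n : ℝ≥0∞) ^ D, ENNReal.rpow_pos (pos_iff_ne_zero.mpr hC0) (by simp), hCt.lt_top, ?_⟩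
  intro f _
  unfold amalgamNormA
  refine iSup₂_le fun r hr => ?_
  refine le_trans ?_ (mul_le_mul_right (le_iSup₂ (f := fun (r : ℝ) (_ : 0 < r) =>
    mixedE n s fun y => volume (eball n y r) ^
          ((1 / α).toReal - invSum n q / (n : ℝ) - invSum n s / (n : ℝ)) *
        mixedLp n q ((eball n y r).indicator f)) r hr) _)
  rw [← mixedE_const_mul _ hCt n s hs]
  refine mixedE_mono n s hs _ _ fun y => ?_
  have hV0 : volume (eball n y r) ≠ 0 := by
    intro h0
    have := two_r_le hn y hr
    rw [h0, ENNReal.zero_rpow_of_pos (by positivity)] at this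
    simp at this
    linarith
  have hVt : volume (eball n y r) ≠ ∞ := by
    refine ne_top_of_le_ne_top ?_ (measure_mono (eball_subset hr))
    exact measure_ball_lt_top.ne
  have key : mixedLp n p ((eball n y r).indicator f) ≤
      ENNReal.ofReal (2 * r) ^ D * mixedLp n q ((eball n y r).indicator f) := by
    refine mixedE_holder (ENNReal.ofReal (2 * r)) (by simpa using hr) ENNReal.ofReal_ne_top n p q hp hpq
      (fun i => Metric.ball (y i) r) (fun i => measurableSet_ball)
      (fun i => Real.volume_ball _ _) _ ?_
    rintro x ⟨i, hi⟩
    have : x ∉ eball n y r := fun hx => hi (by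
      rw [Metric.mem_ball, Real.dist_eq]; exact eball_coord hx i)
    simp [this]
  set V := volume (eball n y r) with hV
  calc _ ≤ V ^ ((1 / α).toReal - invSum n p / (n : ℝ) - invSum n s / (n : ℝ)) *
        (((n : ℝ≥0∞) * V ^ (1 / (n : ℝ))) ^ D * mixedLp n q ((eball n y r).indicator f)) := by
        refine mul_le_mul_right (key.trans (mul_le_mul_left ?_ _)) _
        exact ENNReal.rpow_le_rpow (two_r_le hn y hr) hD
    _ = _ := by
        have e : (1 / α).toReal - invSum n q / (n : ℝ) - invSum n s / (n : ℝ) =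
            ((1 / α).toReal - invSum n p / (n : ℝ) - invSum n s / (n : ℝ)) + 1 / (n : ℝ) * D := by
          rw [hDdef]; ring
        rw [e, ENNReal.rpow_add _ _ hV0 hVt, ENNReal.mul_rpow_of_nonneg _ _ hD,
          ← ENNReal.rpow_mul]
        ring

end MixedAmalgam

end
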